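/- Let d ≥ 2 and let S ⊆ ℕ^d be a generalized numerical semigroup of embedding dimension 2d that is symmetric. Then, up to permutation of coordinates, S is generated by {e₁,…,e_{i−1}, 2e_i, b e_i, e_{i+1},…,e_d} ∪ {e_i + d_j e_j : j ≠ i} for some odd b ≥ 3 and positive integers d_j. -/

import Mathlib

/-- The set of pseudo-Frobenius elements of a submonoid of ℕ^d. -/
def PF {d : ℕ} (S : AddSubmonoid (Fin d → ℕ)) : Set (Fin d → ℕ) :=
  {h | h ∉ S ∧ ∀ s ∈ S, s ≠ 0 → h + s ∈ S}

section Generators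

variable {d : ℕ} {A : Set (Fin d → ℕ)} {i j : Fin d}

lemma eq_single_of_forall_ne {x : Fin d → ℕ} (h : ∀ l, l ≠ i → x l = 0) :
    x = Pi.single i (x i) := by
  ext l
  by_cases hl : l = i
  · subst hl; simp
  · simp [hl, h l hl]

/-- A nonzero element of the closure on a coordinate axis forces a generator on that axis. -/
lemma exists_axis_generator {x : Fin d → ℕ} (hx : x ∈ AddSubmonoid.closure A)
    (h0 : ∀ l, l ≠ i → x l = 0) (hi : x i ≠ 0) :
    ∃ k, k ≠ 0 ∧ Pi.single i k ∈ A := by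
  induction hx using AddSubmonoid.closure_induction with
  | mem x hx =>
    rw [eq_single_of_forall_ne h0] at hx
    exact ⟨x i, hi, hx⟩
  | zero => simp at hi
  | add x y _ _ ihx ihy =>
    simp only [Pi.add_apply, Nat.add_eq_zero_iff] at h0 hi
    by_cases hxi : x i = 0
    · exact ihy (fun l hl => (h0 l hl).2) (by omega)
    · exact ihx (fun l hl => (h0 l hl).1) hxi

/-- A generator with `i`-th coordinate one divides any such element of the closure lying in
the plane of the coordinates `i` and `j`. -/
lemma exists_plane_generator (hij : j ≠ i) {x : Fin d → ℕ} (hx : x ∈ AddSubmonoid.closure A)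
    (h0 : ∀ l, l ≠ i → l ≠ j → x l = 0) (hi : x i = 1) :
    ∃ k, k ≤ x j ∧ Pi.single i 1 + Pi.single j k ∈ A := by
  induction hx using AddSubmonoid.closure_induction with
  | mem x hx =>
    refine ⟨x j, le_rfl, ?_⟩
    convert hx
    ext l
    by_cases hl : l = i
    · subst hl; simp [hi, hij.symm]
    by_cases hl' : l = j
    · subst hl'; simp [hij]
    · simp [hl, hl', h0 l hl hl']
  | zero => simp at hi
  | add x y _ _ ihx ihy =>
    simp only [Pi.add_apply, Nat.add_eq_zero_iff] at h0 hi
    by_cases hxi : x i = 0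
    · obtain ⟨k, hk, hA⟩ := ihy (fun l hl hl' => (h0 l hl hl').2) (by omega)
      exact ⟨k, by simp only [Pi.add_apply]; omega, hA⟩
    · obtain ⟨k, hk, hA⟩ := ihx (fun l hl hl' => (h0 l hl hl').1) (by omega)
      exact ⟨k, by simp only [Pi.add_apply]; omega, hA⟩

/-- Elements of the closure on an axis are sums of generators on that axis. -/
lemma apply_mem_closure_of_axis {B : Set ℕ} (hB : ∀ k, Pi.single i k ∈ A → k ∈ B)
    {x : Fin d → ℕ} (hx : x ∈ AddSubmonoid.closure A) (h0 : ∀ l, l ≠ i → x l = 0) :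
    x i ∈ AddSubmonoid.closure B := by
  induction hx using AddSubmonoid.closure_induction with
  | mem x hx =>
    rw [eq_single_of_forall_ne h0] at hx
    exact AddSubmonoid.subset_closure (hB _ hx)
  | zero => simp
  | add x y _ _ ihx ihy =>
    simp only [Pi.add_apply, Nat.add_eq_zero_iff] at h0
    exact add_mem (ihx fun l hl => (h0 l hl).1) (ihy fun l hl => (h0 l hl).2)

lemma single_one_mem (h : Pi.single i 1 ∈ AddSubmonoid.closure A) :
    Pi.single i 1 ∈ A := by
  have : ∀ x ∈ AddSubmonoid.closure A, (∀ l, l ≠ i → x l = 0) → x i = 1 →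
      Pi.single i 1 ∈ A := by
    intro x hx h0 hi
    induction hx using AddSubmonoid.closure_induction with
    | mem x hx => rw [eq_single_of_forall_ne h0, hi] at hx; exact hx
    | zero => simp at hi
    | add x y _ _ ihx ihy =>
      simp only [Pi.add_apply, Nat.add_eq_zero_iff] at h0 hi
      by_cases hxi : x i = 0
      · exact ihy (fun l hl => (h0 l hl).2) (by omega)
      · exact ihx (fun l hl => (h0 l hl).1) (by omega)
  exact this _ h (by intro l hl; simp [hl]) (by simp)

lemma dvd_of_mem_closure {B : Set ℕ} {g n : ℕ} (hB : ∀ k ∈ B, g ∣ k)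
    (hn : n ∈ AddSubmonoid.closure B) : g ∣ n := by
  induction hn using AddSubmonoid.closure_induction with
  | mem x hx => exact hB x hx
  | zero => simp
  | add x y _ _ ihx ihy => exact dvd_add ihx ihy

end Generators

section Cofinite

variable {d : ℕ} {S : AddSubmonoid (Fin d → ℕ)}

/-- In a cofinite submonoid every ray in a coordinate direction is eventually contained. -/
lemma eventually_add_single_mem (hfin : {x : Fin d → ℕ | x ∉ S}.Finite) (v : Fin d → ℕ)
    (j : Fin d) : ∃ N, ∀ n, N ≤ n → v + Pi.single j n ∈ S := by
  have hinj : Function.Injective fun n : ℕ => v + Pi.single j n := fun m n h =>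
    Pi.single_injective j (add_left_cancel h)
  obtain ⟨N, hN⟩ := (hfin.preimage hinj.injOn).bddAbove
  refine ⟨N + 1, fun n hn => ?_⟩
  by_contra h
  have := hN (show n ∈ _ from h)
  omega

/-- Every gap of a cofinite submonoid lies below a pseudo-Frobenius element. -/
lemma exists_PF_ge (hfin : {x : Fin d → ℕ | x ∉ S}.Finite) {h : Fin d → ℕ} (hh : h ∉ S) :
    ∃ f ∈ PF S, h ≤ f := by
  obtain ⟨f, hf⟩ := (hfin.subset (t := {x | x ∉ S ∧ h ≤ x}) fun x hx => hx.1).exists_maximal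
    ⟨h, hh, le_rfl⟩
  refine ⟨f, ⟨hf.prop.1, fun s _ hs0 => ?_⟩, hf.prop.2⟩
  by_contra hc
  have h1 : f + s ≤ f := hf.le_of_ge ⟨hc, hf.prop.2.trans le_self_add⟩ le_self_add
  exact hs0 (by simpa using h1)

lemma mem_of_forall_single_one_mem {i : Fin d} (hS : ∀ j, j ≠ i → Pi.single j 1 ∈ S)
    {x : Fin d → ℕ} (hi : x i = 0) : x ∈ S := by
  rw [← Finset.univ_sum_single x]
  refine sum_mem fun j _ => ?_
  by_cases hj : j = i
  · subst hj; simp [hi]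
  · have : (Pi.single j (x j) : Fin d → ℕ) = x j • Pi.single j 1 := by
      rw [← Pi.single_smul]; simp
    rw [this]
    exact nsmul_mem (hS j hj) _

/-- A cofinite submonoid missing `e_i` has two distinct nonzero generators on the `i`-th axis. -/
lemma exists_two_axis_generators {A : Set (Fin d → ℕ)} {i : Fin d}
    (hfin : {x : Fin d → ℕ | x ∉ AddSubmonoid.closure A}.Finite)
    (hi : Pi.single i 1 ∉ AddSubmonoid.closure A) :
    ∃ a b, 2 ≤ a ∧ 2 ≤ b ∧ a ≠ b ∧ Pi.single i a ∈ A ∧ Pi.single i b ∈ A := by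
  have hne : ∀ k, Pi.single i k ∈ A → k ≠ 1 := by
    rintro k hk rfl
    exact hi (AddSubmonoid.subset_closure hk)
  obtain ⟨N, hN⟩ := eventually_add_single_mem hfin 0 i
  simp only [zero_add] at hN
  obtain ⟨a, ha0, ha⟩ := exists_axis_generator (i := i) (hN (N + 1) (by omega))
    (by intro l hl; simp [hl]) (by simp)
  have ha1 := hne a ha
  by_contra! hc
  have hall : ∀ k ∈ {k | Pi.single i k ∈ A}, a ∣ k := by
    intro k hk
    have hk1 := hne k hk
    by_cases hk0 : k = 0
    · simp [hk0]
    · by_cases hak : a = k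
      · simp [hak]
      · exact absurd hk (hc a k (by omega) (by omega) hak ha)
  have hdvd : ∀ n, N ≤ n → a ∣ n := fun n hn => by
    have h := apply_mem_closure_of_axis (i := i) (B := {k | Pi.single i k ∈ A})
      (fun k hk => hk) (hN n hn) (by intro l hl; simp [hl])
    rw [Pi.single_eq_same] at h
    exact dvd_of_mem_closure hall h
  have h1 := (Nat.dvd_add_right (hdvd N le_rfl)).1 (hdvd (N + 1) (by omega))
  exact ha1 (Nat.dvd_one.1 h1)

end Cofinite

lemma frobenius_sub_one_mem {a b : ℕ} (ha : 3 ≤ a) (hb : 3 ≤ b) (hab : a.Coprime b) :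
    a * b - a - b - 1 ∈ AddSubmonoid.closure ({a, b} : Set ℕ) := by
  obtain ⟨u, hub, hu⟩ : ∃ u < b, a * u % b = 1 := by
    obtain ⟨m, -, hm⟩ := Nat.exists_mul_mod_eq_one_of_coprime hab (by omega)
    exact ⟨m % b, Nat.mod_lt _ (by omega), by rw [Nat.mul_mod_mod]; exact hm⟩
  have hw := Nat.mod_add_div (a * u) b
  rw [hu] at hw
  set w := a * u / b
  have hw0 : w ≠ 0 := by
    intro h
    rw [h] at hw
    have : a ∣ 1 := ⟨u, by omega⟩
    have := Nat.dvd_one.1 this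
    omega
  rw [AddSubmonoid.mem_closure_pair]
  obtain ⟨v, rfl⟩ := Nat.exists_eq_add_of_lt hub
  obtain ⟨w', hw'⟩ := Nat.exists_eq_succ_of_ne_zero hw0
  refine ⟨v, w', ?_⟩
  rw [hw'] at hw
  simp only [smul_eq_mul, Nat.succ_eq_add_one] at *
  have : a * (u + v + 1) = v * a + w' * (u + v + 1) + 1 + (u + v + 1) + a := by
    nlinarith
  omega

/-- The minimal generating set of a cofinite submonoid of embedding dimension `2 * d`, `d ≥ 2`,
other than `ℕ^d`. -/
lemma exists_generators_of_card_eq {d : ℕ} {A : Finset (Fin d → ℕ)}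
    (hfin : {x : Fin d → ℕ | x ∉ AddSubmonoid.closure (A : Set (Fin d → ℕ))}.Finite)
    (hcard : A.card = 2 * d) {i : Fin d}
    (hi : Pi.single i 1 ∉ AddSubmonoid.closure (A : Set (Fin d → ℕ))) :
    ∃ (a b : ℕ) (m : Fin d → ℕ), 2 ≤ a ∧ 2 ≤ b ∧ (∀ j, j ≠ i → 1 ≤ m j) ∧
      (A : Set (Fin d → ℕ)) =
        {x | ∃ j : Fin d, j ≠ i ∧ x = Pi.single j 1} ∪
         {Pi.single i a, Pi.single i b} ∪
         {x | ∃ j : Fin d, j ≠ i ∧ x = Pi.single i 1 + Pi.single j (m j)} := by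
  classical
  obtain ⟨a, b, ha, hb, hab, haA, hbA⟩ := exists_two_axis_generators hfin hi
  have hx : ∀ j, ∃ k, k ≠ 0 ∧ Pi.single j k ∈ (A : Set (Fin d → ℕ)) ∧ (j = i → k = a) := by
    intro j
    by_cases hj : j = i
    · subst hj; exact ⟨a, by omega, haA, fun _ => rfl⟩
    · obtain ⟨N, hN⟩ := eventually_add_single_mem hfin 0 j
      obtain ⟨k, hk, hkA⟩ := exists_axis_generator (i := j) (hN (N + 1) (by omega))
        (by intro l hl; simp [hl]) (by simp)
      exact ⟨k, hk, hkA, fun h => absurd h hj⟩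
  choose x hx0 hxA hxi using hx
  have hm : ∀ j, ∃ k, j ≠ i →
      1 ≤ k ∧ Pi.single i 1 + Pi.single j k ∈ (A : Set (Fin d → ℕ)) := by
    intro j
    by_cases hj : j = i
    · exact ⟨0, fun h => absurd hj h⟩
    · obtain ⟨N, hN⟩ := eventually_add_single_mem hfin (Pi.single i 1) j
      obtain ⟨k, -, hkA⟩ := exists_plane_generator (i := i) hj (hN N le_rfl)
        (by intro l hl hl'; simp [hl, hl']) (by simp [Ne.symm hj])
      refine ⟨k, fun _ => ⟨Nat.one_le_iff_ne_zero.2 ?_, hkA⟩⟩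
      rintro rfl
      exact hi (AddSubmonoid.subset_closure (by simpa using hkA))
  choose m hm using hm
  let g : Fin d ⊕ Fin d → (Fin d → ℕ) := Sum.elim (fun j => Pi.single j (x j))
    (fun j => if j = i then Pi.single i b else Pi.single i 1 + Pi.single j (m j))
  have hgA : Finset.univ.image g ⊆ A := by
    intro y hy
    simp only [Finset.mem_image, Finset.mem_univ, true_and] at hy
    obtain ⟨j | j, rfl⟩ := hy
    · exact hxA j
    · by_cases hj : j = i
      · simpa [g, hj] using hbA
      · simpa [g, hj] using (hm j hj).2
  have hsingle : ∀ {j l : Fin d} {p q : ℕ}, p ≠ 0 →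
      (Pi.single j p : Fin d → ℕ) = Pi.single l q → j = l ∧ p = q := by
    intro j l p q hp h
    have h1 := congrFun h j
    by_cases hjl : j = l
    · subst hjl; simpa using h1
    · simp [hjl, hp] at h1
  have hmix : ∀ {j l : Fin d} {p q : ℕ}, j ≠ i → p ≠ 0 →
      (Pi.single i 1 + Pi.single j p : Fin d → ℕ) ≠ Pi.single l q := by
    intro j l p q hj hp h
    have h1 := congrFun h i
    have h2 := congrFun h j
    by_cases hl : i = l
    · subst hl; simp [hj, hp] at h2
    · simp [hl] at h1
  have hginj : Function.Injective g := by
    rintro (j | j) (l | l) h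
    · exact congrArg _ (hsingle (hx0 j) h).1
    · exfalso
      by_cases hl : l = i
      · simp only [g, Sum.elim_inl, Sum.elim_inr, hl, if_true] at h
        obtain ⟨rfl, h2⟩ := hsingle (hx0 j) h
        exact hab ((hxi j rfl).symm.trans h2)
      · simp only [g, Sum.elim_inl, Sum.elim_inr, hl, if_false] at h
        exact hmix hl (Nat.one_le_iff_ne_zero.1 (hm l hl).1) h.symm
    · exfalso
      by_cases hl : j = i
      · simp only [g, Sum.elim_inl, Sum.elim_inr, hl, if_true] at h
        obtain ⟨rfl, h2⟩ := hsingle (hx0 l) h.symm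
        exact hab ((hxi l rfl).symm.trans h2)
      · simp only [g, Sum.elim_inl, Sum.elim_inr, hl, if_false] at h
        exact hmix hl (Nat.one_le_iff_ne_zero.1 (hm j hl).1) h
    · congr 1
      by_cases hj : j = i <;> by_cases hl : l = i
      · rw [hj, hl]
      · simp only [g, Sum.elim_inr, hl, hj, if_false, if_true] at h
        exact absurd h.symm (hmix hl (Nat.one_le_iff_ne_zero.1 (hm l hl).1))
      · simp only [g, Sum.elim_inr, hl, hj, if_false, if_true] at h
        exact absurd h (hmix hj (Nat.one_le_iff_ne_zero.1 (hm j hj).1))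
      · simp only [g, Sum.elim_inr, hl, hj, if_false] at h
        exact (hsingle (Nat.one_le_iff_ne_zero.1 (hm j hj).1) (add_left_cancel h)).1
  have hA : A = Finset.univ.image g := by
    refine (Finset.eq_of_subset_of_card_le hgA ?_).symm
    rw [Finset.card_image_of_injective _ hginj, hcard]
    simp [two_mul]
  have haxis : ∀ {j : Fin d} {k : ℕ}, j ≠ i → k ≠ 0 →
      Pi.single j k ∈ (A : Set (Fin d → ℕ)) → k = x j := by
    intro j k hj hk hkA
    rw [hA] at hkA
    simp only [Finset.coe_image, Finset.coe_univ, Set.image_univ, Set.mem_range] at hkA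
    obtain ⟨l | l, hl⟩ := hkA
    · obtain ⟨rfl, h⟩ := hsingle (hx0 l) hl
      exact h.symm
    · exfalso
      by_cases hli : l = i
      · simp only [g, Sum.elim_inr, hli, if_true] at hl
        exact hj (hsingle (by omega) hl).1.symm
      · simp only [g, Sum.elim_inr, hli, if_false] at hl
        exact hmix hli (Nat.one_le_iff_ne_zero.1 (hm l hli).1) hl
  have hx1 : ∀ j, j ≠ i → x j = 1 := by
    intro j hj
    by_cases hjS : Pi.single j 1 ∈ AddSubmonoid.closure (A : Set (Fin d → ℕ))
    · exact (haxis hj one_ne_zero (single_one_mem hjS)).symm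
    · obtain ⟨p, q, hp, hq, hpq, hpA, hqA⟩ := exists_two_axis_generators hfin hjS
      exact absurd ((haxis hj (by omega) hpA).trans (haxis hj (by omega) hqA).symm) hpq
  refine ⟨a, b, m, ha, hb, fun j hj => (hm j hj).1, Set.Subset.antisymm ?_ ?_⟩
  · intro y hy
    rw [hA] at hy
    simp only [Finset.coe_image, Finset.coe_univ, Set.image_univ, Set.mem_range] at hy
    obtain ⟨j | j, rfl⟩ := hy
    · by_cases hj : j = i
      · left; right; left; simp [g, hj, hxi i rfl]
      · left; left; exact ⟨j, hj, by simp [g, hx1 j hj]⟩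
    · by_cases hj : j = i
      · left; right; right; simp [g, hj]
      · right; exact ⟨j, hj, by simp [g, hj]⟩
  · rintro y ((⟨j, hj, rfl⟩ | rfl | rfl) | ⟨j, hj, rfl⟩)
    · exact hx1 j hj ▸ hxA j
    · exact haA
    · exact hbA
    · exact (hm j hj).2

section Structure

variable {d : ℕ} {S : AddSubmonoid (Fin d → ℕ)} {i : Fin d} {a b : ℕ} {m : Fin d → ℕ}

lemma single_mem_iff (hm : ∀ j, j ≠ i → 1 ≤ m j)
    (hS : S = AddSubmonoid.closure
        ({x | ∃ j : Fin d, j ≠ i ∧ x = Pi.single j 1} ∪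
         {Pi.single i a, Pi.single i b} ∪
         {x | ∃ j : Fin d, j ≠ i ∧ x = Pi.single i 1 + Pi.single j (m j)})) (n : ℕ) :
    Pi.single i n ∈ S ↔ n ∈ AddSubmonoid.closure ({a, b} : Set ℕ) := by
  constructor
  · intro h
    rw [hS] at h
    have := apply_mem_closure_of_axis (i := i) (B := {a, b}) ?_ h (by intro l hl; simp [hl])
    · simpa using this
    · rintro k ((⟨j, hj, h⟩ | h | h) | ⟨j, hj, h⟩)
      · have := congrFun h j
        simp [hj] at this
      · left; exact Pi.single_injective i h
      · right; exact Pi.single_injective i h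
      · have h1 := congrFun h j
        have h2 := hm j hj
        simp only [Pi.add_apply, Pi.single_eq_same, Pi.single_eq_of_ne hj] at h1
        omega
  · intro h
    induction h using AddSubmonoid.closure_induction with
    | mem n hn =>
      rw [hS]
      apply AddSubmonoid.subset_closure
      rcases hn with rfl | rfl
      · left; right; left; rfl
      · left; right; right; rfl
    | zero => simp
    | add x y _ _ ihx ihy => rw [Pi.single_add]; exact add_mem ihx ihy

lemma coprime_of_cofinite (hfin : {x : Fin d → ℕ | x ∉ S}.Finite)
    (hS : ∀ n, Pi.single i n ∈ S ↔ n ∈ AddSubmonoid.closure ({a, b} : Set ℕ)) :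
    a.Coprime b := by
  obtain ⟨N, hN⟩ := eventually_add_single_mem hfin 0 i
  have hdvd : ∀ n, N ≤ n → a.gcd b ∣ n := fun n hn =>
    dvd_of_mem_closure (B := {a, b})
      (by rintro k (rfl | rfl); exacts [Nat.gcd_dvd_left _ _, Nat.gcd_dvd_right _ _])
      ((hS n).1 (by simpa using hN n hn))
  have h1 := (Nat.dvd_add_right (hdvd N le_rfl)).1 (hdvd (N + 1) (by omega))
  exact Nat.dvd_one.1 h1

/-- If both generators on the distinguished axis are at least `3`, then `2 e_i + m_j e_j` is
a gap. -/
lemma two_single_add_single_notMem (hm : ∀ j, j ≠ i → 1 ≤ m j)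
    (hS : S = AddSubmonoid.closure
        ({x | ∃ j : Fin d, j ≠ i ∧ x = Pi.single j 1} ∪
         {Pi.single i a, Pi.single i b} ∪
         {x | ∃ j : Fin d, j ≠ i ∧ x = Pi.single i 1 + Pi.single j (m j)}))
    (ha : 3 ≤ a) (hb : 3 ≤ b) {j : Fin d} (hj : j ≠ i) :
    Pi.single i 2 + Pi.single j (m j) ∉ S := by
  have key : ∀ x ∈ S, (∀ l, l ≠ i → l ≠ j → x l = 0) → x i ≤ 2 → x i * m j ≤ x j := by
    intro x hx h0 hxi
    rw [hS] at hx
    induction hx using AddSubmonoid.closure_induction with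
    | mem x hx =>
      rcases hx with ((⟨l, hl, rfl⟩ | rfl | rfl) | ⟨l, hl, rfl⟩)
      · simp [hl.symm]
      · simp at hxi; omega
      · simp at hxi; omega
      · by_cases hlj : l = j
        · subst hlj; simp [hl, hl.symm]
        · have h1 := h0 l hl hlj
          have h2 := hm l hl
          simp only [Pi.add_apply, Pi.single_eq_same, Pi.single_eq_of_ne hl] at h1
          omega
    | zero => simp
    | add x y _ _ ihx ihy =>
      simp only [Pi.add_apply, Nat.add_eq_zero_iff] at h0 hxi ⊢
      have h1 := ihx (fun l hl hl' => (h0 l hl hl').1) (by omega)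
      have h2 := ihy (fun l hl hl' => (h0 l hl hl').2) (by omega)
      rw [add_mul]
      omega
  intro h
  have h1 := key _ h (by intro l hl hl'; simp [hl, hl']) (by simp [hj.symm])
  have h2 := hm j hj
  simp [hj, hj.symm] at h1
  omega

/-- Symmetry forces one of the generators on the distinguished axis to be `2`. -/
lemma lt_three_of_PF_ncard_eq_one (hd : 2 ≤ d) (hfin : {x : Fin d → ℕ | x ∉ S}.Finite)
    (hm : ∀ j, j ≠ i → 1 ≤ m j)
    (hS : S = AddSubmonoid.closure
        ({x | ∃ j : Fin d, j ≠ i ∧ x = Pi.single j 1} ∪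
         {Pi.single i a, Pi.single i b} ∪
         {x | ∃ j : Fin d, j ≠ i ∧ x = Pi.single i 1 + Pi.single j (m j)}))
    (hsym : (PF S).ncard = 1) : a < 3 ∨ b < 3 := by
  by_contra! hc
  obtain ⟨ha, hb⟩ := hc
  have haxis := single_mem_iff hm hS
  have hab := coprime_of_cofinite hfin haxis
  obtain ⟨f, hf⟩ := Set.ncard_eq_one.1 hsym
  have hfS : f ∉ S := (hf ▸ Set.mem_singleton f : f ∈ PF S).1
  have hle : ∀ h, h ∉ S → h ≤ f := by
    intro h hh
    obtain ⟨f', hf', hle⟩ := exists_PF_ge hfin hh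
    rw [hf, Set.mem_singleton_iff] at hf'
    exact hf' ▸ hle
  have hone : ∀ j, j ≠ i → Pi.single j 1 ∈ S := fun j hj => by
    rw [hS]
    exact AddSubmonoid.subset_closure (Or.inl (Or.inl ⟨j, hj, rfl⟩))
  have hfrob := frobeniusNumber_pair hab (by omega) (by omega)
  have hfi : f i = a * b - a - b := by
    apply le_antisymm
    · refine hfrob.2 fun hmem => hfS ?_
      have h1 : f = Pi.single i (f i) + Function.update f i 0 := by
        ext l
        by_cases hl : l = i
        · subst hl; simp
        · simp [hl]
      rw [h1]
      exact add_mem ((haxis _).2 hmem) (mem_of_forall_single_one_mem hone (by simp))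
    · have := hle _ (mt (haxis _).1 hfrob.1) i
      simpa using this
  have hpos : 1 ≤ a * b - a - b := by
    have : a + b + 1 ≤ a * b := by nlinarith
    omega
  obtain ⟨j, hj⟩ : ∃ j : Fin d, j ≠ i := by
    have : Nontrivial (Fin d) := Fin.nontrivial_iff_two_le.2 hd
    exact exists_ne i
  have hfj : m j ≤ f j := by
    have := hle _ (two_single_add_single_notMem hm hS ha hb hj) j
    simpa [hj] using this
  have hdecomp : f = Pi.single i (a * b - a - b - 1) + (Pi.single i 1 + Pi.single j (m j)) +
      Function.update (Function.update f j (f j - m j)) i 0 := by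
    ext l
    by_cases hl : l = i
    · subst hl; simp [hj.symm]; omega
    by_cases hl' : l = j
    · subst hl'; simp [hl]; omega
    · simp [hl, hl']
  apply hfS
  rw [hdecomp]
  refine add_mem (add_mem ((haxis _).2 (frobenius_sub_one_mem ha hb hab)) ?_)
    (mem_of_forall_single_one_mem hone (by simp))
  rw [hS]
  exact AddSubmonoid.subset_closure (Or.inr ⟨j, hj, rfl⟩)

end Structure

/-- structure of symmetric GNS of embedding dimension 2d (d ≥ 2),
up to permutation of coordinates. -/
theorem structure_symmetric_edim_2d
    (d : ℕ) (hd : 2 ≤ d)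
    (S : AddSubmonoid (Fin d → ℕ))
    (hfin : {x : Fin d → ℕ | x ∉ S}.Finite)
    (A : Finset (Fin d → ℕ))
    (hgen : AddSubmonoid.closure (A : Set (Fin d → ℕ)) = S)
    (hmin : ∀ B ⊂ A, AddSubmonoid.closure (B : Set (Fin d → ℕ)) ≠ S)
    (hcard : A.card = 2 * d)
    (hsym : (PF S).ncard = 1) :
    ∃ (i : Fin d) (b : ℕ) (dj : Fin d → ℕ),
      Odd b ∧ 3 ≤ b ∧ (∀ j : Fin d, j ≠ i → 1 ≤ dj j) ∧
      S = AddSubmonoid.closure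
        ({x | ∃ j : Fin d, j ≠ i ∧ x = Pi.single j 1} ∪
         {Pi.single i 2, Pi.single i b} ∪
         {x | ∃ j : Fin d, j ≠ i ∧ x = Pi.single i 1 + Pi.single j (dj j)}) := by
  subst hgen
  obtain ⟨i, hi⟩ : ∃ i : Fin d,
      Pi.single i 1 ∉ AddSubmonoid.closure (A : Set (Fin d → ℕ)) := by
    by_contra! hc
    obtain ⟨f, hf⟩ := Set.ncard_eq_one.1 hsym
    have hfS := (hf ▸ Set.mem_singleton f : f ∈ PF (AddSubmonoid.closure _)).1
    apply hfS
    rw [← Finset.univ_sum_single f]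
    refine sum_mem fun j _ => ?_
    have : (Pi.single j (f j) : Fin d → ℕ) = f j • Pi.single j 1 := by
      rw [← Pi.single_smul]; simp
    rw [this]
    exact nsmul_mem (hc j) _
  obtain ⟨a, b, m, ha, hb, hm, hA⟩ := exists_generators_of_card_eq hfin hcard hi
  have hS := congrArg AddSubmonoid.closure hA
  have hab := coprime_of_cofinite hfin (single_mem_iff hm hS)
  rcases lt_three_of_PF_ncard_eq_one hd hfin hm hS hsym with h | h
  · obtain rfl : a = 2 := by omega
    have hodd : Odd b := Nat.coprime_two_left.1 hab
    exact ⟨i, b, m, hodd, by have := Nat.odd_iff.1 hodd; omega, hm, hS⟩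
  · obtain rfl : b = 2 := by omega
    have hodd : Odd a := Nat.coprime_two_right.1 hab
    rw [Set.pair_comm] at hS
    exact ⟨i, a, m, hodd, by have := Nat.odd_iff.1 hodd; omega, hm, hS⟩
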